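/- CVaR special case (Natarajan–Sim–Teo rule): Let h(u) = (u−α)₊/(1−α) for α ∈ [0,1) (the distortion of CVaR_α), and set η = (1−α)(1−c/p). If η ≤ σ²/(μ²+σ²), then ρ_h^wc(μ,σ) = 0 and the optimal order quantity is x* = 0; if η > σ²/(μ²+σ²), then ρ_h^wc(μ,σ) = (p−c)·(−μ + σ·sqrt((1−η)/η)) and the optimal order quantity is x* = μ + σ·(2η−1)/(2·sqrt(η(1−η))). -/

import Mathlib

open MeasureTheory Set

namespace NV

noncomputable section

/-- `hD h u`: the left derivative of `h` at `u` for `u ≠ 0`, and the right derivative at `0`. -/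
def hD (h : ℝ → ℝ) (u : ℝ) : ℝ :=
  if u = 0 then derivWithin h (Set.Ioi (0 : ℝ)) 0 else derivWithin h (Set.Iio u) u

/-- A distortion function: nondecreasing on `[0,1]` with `h 0 = 0`, `h 1 = 1`. -/
def IsDistortion (h : ℝ → ℝ) : Prop :=
  MonotoneOn h (Set.Icc (0 : ℝ) 1) ∧ h 0 = 0 ∧ h 1 = 1

/-- Membership in `H₂`: a convex distortion function with square-integrable derivative. -/
def MemH2 (h : ℝ → ℝ) : Prop :=
  IsDistortion h ∧ ConvexOn ℝ (Set.Icc (0 : ℝ) 1) h ∧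
    IntegrableOn (fun u => (hD h u) ^ 2) (Set.Ioo (0 : ℝ) 1)

/-- Value-at-risk of `X` at level `α` under `P`. -/
def VaR {Ω : Type*} [MeasurableSpace Ω] (P : Measure Ω) (X : Ω → ℝ) (α : ℝ) : ℝ :=
  sInf {t : ℝ | α ≤ (P {ω | X ω ≤ t}).toReal}

/-- Distortion functional `ρ_h(X) = ∫₀¹ VaR_u(X) h'(u) du`. -/
def rho {Ω : Type*} [MeasurableSpace Ω] (h : ℝ → ℝ) (P : Measure Ω) (X : Ω → ℝ) : ℝ :=
  ∫ u in Set.Ioo (0 : ℝ) 1, VaR P X u * hD h u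

/-- Loss of ordering `x`: `ψ(x,p,c) = p·max{−S,−x} + c·x`, as a function of demand `s`. -/
def loss (p c x s : ℝ) : ℝ := p * max (-s) (-x) + c * x

/-- Distributions on `[0,∞)` with mean `μ` and second moment `μ² + σ²`. -/
def momentSet (μ σ : ℝ) : Set (Measure ℝ) :=
  {P | IsProbabilityMeasure P ∧ P (Set.Iio (0 : ℝ)) = 0 ∧
      (∫ s, s ∂P) = μ ∧ (∫ s, s ^ 2 ∂P) = μ ^ 2 + σ ^ 2}

/-- Inner worst-case risk `sup_{F ∈ S(μ,σ)} ρ_h^F(ψ(x,p,c))` at order quantity `x`. -/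
def wcInner (h : ℝ → ℝ) (p c μ σ x : ℝ) : ℝ :=
  sSup ((fun P => rho h P (loss p c x)) '' momentSet μ σ)

/-- Worst-case risk `ρ_h^wc(μ,σ) = inf_{x ≥ 0} sup_{F ∈ S(μ,σ)} ρ_h^F(ψ(x,p,c))`. -/
def wcRisk (h : ℝ → ℝ) (p c μ σ : ℝ) : ℝ :=
  sInf ((fun x => wcInner h p c μ σ x) '' Set.Ici (0 : ℝ))

/-- Generalized inverse `s* = h⁻¹(β)`. -/
def sstar (h : ℝ → ℝ) (β : ℝ) : ℝ := sInf {u ∈ Set.Icc (0 : ℝ) 1 | β ≤ h u}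

/-- `Δ_{s,t} = sqrt(t ∫_s^t h'(u)² du − (h(t) − β)²)`. -/
def Del (h : ℝ → ℝ) (β s t : ℝ) : ℝ :=
  Real.sqrt (t * (∫ u in Set.Ioc s t, (hD h u) ^ 2) - (h t - β) ^ 2)

/-- `σ_t = sqrt(t (μ² + σ²) − μ²)`. -/
def sigt (μ σ t : ℝ) : ℝ := Real.sqrt (t * (μ ^ 2 + σ ^ 2) - μ ^ 2)

/-- `h_s(u) = (h(u) − h(s))/(1 − h(s))` for `s < u ≤ 1`, and `0` otherwise. -/
def hsub (h : ℝ → ℝ) (s u : ℝ) : ℝ :=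
  if s < u ∧ u ≤ 1 then (h u - h s) / (1 - h s) else 0

/-- `k_{s,t}`. -/
def kst (h : ℝ → ℝ) (μ σ s t : ℝ) : ℝ :=
  sigt μ σ t /
    Real.sqrt (t * (∫ u in Set.Ioc (0 : ℝ) t, (hD (hsub h s) u) ^ 2) - (hsub h s t) ^ 2)

/-- `ℓ_{s,t}`. -/
def lst (h : ℝ → ℝ) (μ σ s t : ℝ) : ℝ :=
  -(μ / t) - kst h μ σ s t * hsub h s t / t

/-- The feasible region `D`. -/
def Dset (h : ℝ → ℝ) (μ σ : ℝ) : Set (ℝ × ℝ) :=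
  {q | 0 ≤ q.1 ∧ q.1 ≤ q.2 ∧ q.2 ≤ 1 ∧ μ ^ 2 / (μ ^ 2 + σ ^ 2) ≤ q.2 ∧
      kst h μ σ q.1 q.2 * hD (hsub h q.1) q.2 + lst h μ σ q.1 q.2 ≤ 0}

/-- `g_x(s,t)`. -/
def gfun (h : ℝ → ℝ) (μ σ x : ℝ) (q : ℝ × ℝ) : ℝ :=
  -(h q.1) * x - (μ / q.2) * (h q.2 - h q.1) +
    (sigt μ σ q.2 / q.2) *
      Real.sqrt (q.2 * (∫ u in Set.Ioc q.1 q.2, (hD h u) ^ 2) - (h q.2 - h q.1) ^ 2)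

/-- `t*`: the largest `t ∈ [1/(1+r²),1]` satisfying the defining inequality. -/
def tstar (h : ℝ → ℝ) (β r : ℝ) : ℝ :=
  sSup {t ∈ Set.Icc (1 / (1 + r ^ 2)) (1 : ℝ) |
    (1 + r ^ 2) * (t * hD h t - h t + β) ^ 2 -
      (∫ u in Set.Ioo (0 : ℝ) 1, (hD h u - h t + β) ^ 2) ≤ 0}

end

end NV

namespace NV

section Quantile

variable {Ω : Type*} [MeasurableSpace Ω] {P : Measure Ω} [IsProbabilityMeasure P] {X : Ω → ℝ}

lemma VaR_le_iff (hX : Measurable X) {u : ℝ} (hu : u ∈ Ioo (0 : ℝ) 1) (t : ℝ) :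
    VaR P X u ≤ t ↔ u ≤ (P {ω | X ω ≤ t}).toReal := by
  have : IsProbabilityMeasure (P.map X) := Measure.isProbabilityMeasure_map hX.aemeasurable
  have hF : ∀ s, (P {ω | X ω ≤ s}).toReal = ProbabilityTheory.cdf (P.map X) s := fun s => by
    rw [ProbabilityTheory.cdf_eq_real, map_measureReal_apply hX measurableSet_Iic]
    rfl
  set F := ProbabilityTheory.cdf (P.map X)
  have hV : VaR P X u = sInf {s | u ≤ F s} := by simp only [VaR, hF]
  rw [hV, hF]
  obtain ⟨b, hb⟩ :=
    ((ProbabilityTheory.tendsto_cdf_atBot (P.map X)).eventually_lt_const hu.1).exists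
  obtain ⟨d, hd⟩ :=
    ((ProbabilityTheory.tendsto_cdf_atTop (P.map X)).eventually_const_lt hu.2).exists
  have hbdd : BddBelow {s | u ≤ F s} :=
    ⟨b, fun s hs => le_of_not_gt fun hsb => (hb.trans_le hs).not_ge (F.mono hsb.le)⟩
  refine ⟨fun hle => ?_, fun hle => csInf_le hbdd hle⟩
  have hlim : Filter.Tendsto F (nhdsWithin t (Ioi t)) (nhds (F t)) :=
    (F.right_continuous t).mono Ioi_subset_Ici_self
  refine ge_of_tendsto hlim ?_
  filter_upwards [self_mem_nhdsWithin] with s hs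
  obtain ⟨r, hr, hrs⟩ := exists_lt_of_csInf_lt ⟨d, hd.le⟩ (hle.trans_lt hs)
  exact le_trans hr (F.mono hrs.le)

lemma le_VaR (hX : Measurable X) {u : ℝ} (hu : u ∈ Ioo (0 : ℝ) 1) {m : ℝ}
    (hm : ∀ t < m, (P {ω | X ω ≤ t}).toReal < u) : m ≤ VaR P X u :=
  le_of_not_gt fun hlt => (hm _ hlt).not_ge ((VaR_le_iff hX hu _).1 le_rfl)

lemma le_VaR_of_forall_le (hX : Measurable X) {u : ℝ} (hu : u ∈ Ioo (0 : ℝ) 1) {m : ℝ}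
    (hm : ∀ ω, m ≤ X ω) : m ≤ VaR P X u := by
  refine le_VaR hX hu fun t ht => ?_
  have : {ω | X ω ≤ t} = ∅ := eq_empty_of_forall_notMem fun ω hω => (ht.trans_le (hm ω)).not_ge hω
  simpa [this] using hu.1

lemma monotoneOn_VaR (hX : Measurable X) : MonotoneOn (VaR P X) (Ioo (0 : ℝ) 1) :=
  fun _ hu _ hv huv =>
    (VaR_le_iff hX hu _).2 (huv.trans ((VaR_le_iff hX hv _).1 le_rfl))

lemma aemeasurable_VaR (hX : Measurable X) :
    AEMeasurable (VaR P X) (volume.restrict (Ioo (0 : ℝ) 1)) :=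
  aemeasurable_restrict_of_monotoneOn measurableSet_Ioo (monotoneOn_VaR hX)

lemma map_VaR (hX : Measurable X) :
    (volume.restrict (Ioo (0 : ℝ) 1)).map (VaR P X) = P.map X := by
  have : IsProbabilityMeasure (P.map X) := Measure.isProbabilityMeasure_map hX.aemeasurable
  have : IsProbabilityMeasure (volume.restrict (Ioo (0 : ℝ) 1)) := ⟨by simp⟩
  have : IsProbabilityMeasure ((volume.restrict (Ioo (0 : ℝ) 1)).map (VaR P X)) :=
    Measure.isProbabilityMeasure_map (aemeasurable_VaR hX)
  refine Measure.ext_of_Iic _ _ fun t => ?_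
  rw [Measure.map_apply_of_aemeasurable (aemeasurable_VaR hX) measurableSet_Iic,
    Measure.map_apply hX measurableSet_Iic, Measure.restrict_apply' measurableSet_Ioo]
  set q := (P {ω | X ω ≤ t}).toReal with hq
  have hq1 : q ≤ 1 := ENNReal.toReal_le_of_le_ofReal zero_le_one (by simpa using prob_le_one)
  have hset : VaR P X ⁻¹' Iic t ∩ Ioo 0 1 = Ioc 0 q ∩ Ioo 0 1 := by
    ext u
    simp only [mem_inter_iff, mem_preimage, mem_Iic, mem_Ioc]
    exact and_congr_left fun hu => by rw [VaR_le_iff hX hu]; simp [hu.1, hq]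
  have hae : (Ioc 0 q ∩ Ioo 0 1 : Set ℝ) =ᵐ[volume] (Ioc 0 q ∩ Ioc 0 1 : Set ℝ) :=
    Filter.EventuallyEq.rfl.inter Ioo_ae_eq_Ioc
  rw [hset, measure_congr hae, Ioc_inter_Ioc, max_self, min_eq_left hq1, Real.volume_Ioc,
    sub_zero, hq, ENNReal.ofReal_toReal (measure_ne_top _ _)]
  rfl

lemma integrableOn_VaR (hX : Measurable X) (hXi : Integrable X P) :
    IntegrableOn (VaR P X) (Ioo (0 : ℝ) 1) := by
  have hid : Integrable id (P.map X) :=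
    (integrable_map_measure aestronglyMeasurable_id hX.aemeasurable).2 hXi
  rw [← map_VaR hX] at hid
  exact (integrable_map_measure aestronglyMeasurable_id (aemeasurable_VaR hX)).1 hid

lemma integral_VaR (hX : Measurable X) :
    ∫ u in Ioo (0 : ℝ) 1, VaR P X u = ∫ ω, X ω ∂P := by
  have h₁ := integral_map (aemeasurable_VaR (P := P) hX)
    (f := fun y : ℝ => y) aestronglyMeasurable_id
  have h₂ := integral_map (hX.aemeasurable (μ := P)) (f := fun y : ℝ => y) aestronglyMeasurable_id
  rw [← h₁, map_VaR hX, h₂]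

end Quantile

section CVaR

lemma hD_cvar {α : ℝ} {u : ℝ} (hu : u ≠ 0) :
    hD (fun v => max (v - α) 0 / (1 - α)) u = (Ioi α).indicator (fun _ => 1 / (1 - α)) u := by
  rw [hD, if_neg hu]
  by_cases hαu : α < u
  · rw [indicator_of_mem (mem_Ioi.2 hαu)]
    have hd : HasDerivAt (fun v : ℝ => (v - α) / (1 - α)) (1 / (1 - α)) u :=
      ((hasDerivAt_id u).sub_const α).div_const _
    refine (hd.congr_of_eventuallyEq ?_).hasDerivWithinAt.derivWithin (uniqueDiffWithinAt_Iio u)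
    filter_upwards [lt_mem_nhds hαu] with v hv
    rw [max_eq_left (sub_nonneg.2 hv.le)]
  · rw [indicator_of_notMem (by simpa using hαu)]
    have hz : ∀ v ≤ u, max (v - α) 0 / (1 - α) = 0 := fun v hv => by
      rw [max_eq_right (by linarith), zero_div]
    rw [derivWithin_congr (s := Iio u) (f := fun _ => (0 : ℝ))
      (fun v hv => hz v (le_of_lt hv)) (hz u le_rfl)]
    simp

variable {Ω : Type*} [MeasurableSpace Ω] {P : Measure Ω} {X : Ω → ℝ} {α : ℝ}

lemma rho_cvar (hα : 0 ≤ α) :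
    rho (fun v => max (v - α) 0 / (1 - α)) P X = (∫ u in Ioo α 1, VaR P X u) / (1 - α) := by
  have hcongr : rho (fun v => max (v - α) 0 / (1 - α)) P X =
      ∫ u in Ioo (0 : ℝ) 1, (Ioi α).indicator (fun u => VaR P X u / (1 - α)) u := by
    refine setIntegral_congr_fun measurableSet_Ioo fun u hu => ?_
    simp only [hD_cvar hu.1.ne', indicator_apply]
    split_ifs <;> ring
  have hset : Ioo (0 : ℝ) 1 ∩ Ioi α = Ioo α 1 := by
    rw [inter_comm, Ioi_inter_Ioo, max_eq_left hα]
  rw [hcongr, setIntegral_indicator measurableSet_Ioi, hset, integral_div]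

variable [IsProbabilityMeasure P]

lemma rho_cvar_le (hα : α ∈ Ico (0 : ℝ) 1) (hX : Measurable X) (hXi : Integrable X P) {v : ℝ}
    (hv : ∀ ω, v ≤ X ω) :
    rho (fun v => max (v - α) 0 / (1 - α)) P X ≤ v + (∫ ω, X ω ∂P - v) / (1 - α) := by
  have hα1 : 0 < 1 - α := sub_pos.2 hα.2
  have hsub : Ioo α 1 ⊆ Ioo (0 : ℝ) 1 := Ioo_subset_Ioo_left hα.1
  have hVi := integrableOn_VaR hX hXi
  have hmono : ∫ u in Ioo α 1, (VaR P X u - v) ≤ ∫ u in Ioo (0 : ℝ) 1, (VaR P X u - v) := by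
    refine setIntegral_mono_set (hVi.sub (integrable_const v)) ?_ hsub.eventuallyLE
    filter_upwards [ae_restrict_mem measurableSet_Ioo] with u hu
    exact sub_nonneg.2 (le_VaR_of_forall_le hX hu hv)
  rw [integral_sub (hVi.mono_set hsub) (integrable_const v),
    integral_sub hVi (integrable_const v), integral_VaR hX] at hmono
  simp only [integral_const, measureReal_restrict_apply MeasurableSet.univ, univ_inter,
    Real.volume_real_Ioo_of_le hα.2.le, Real.volume_real_Ioo_of_le zero_le_one, smul_eq_mul]
    at hmono
  rw [rho_cvar hα.1, div_le_iff₀ hα1, add_mul, div_mul_cancel₀ _ hα1.ne']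
  linarith

lemma le_rho_cvar (hα : α ∈ Ico (0 : ℝ) 1) (hX : Measurable X) (hXi : Integrable X P)
    {t m M : ℝ} (ht : t ∈ Icc α 1) (hm : ∀ u ∈ Ioo (0 : ℝ) 1, m ≤ VaR P X u)
    (hM : ∀ u ∈ Ioo (0 : ℝ) 1, t < u → M ≤ VaR P X u) :
    ((t - α) * m + (1 - t) * M) / (1 - α) ≤ rho (fun v => max (v - α) 0 / (1 - α)) P X := by
  have hVi := integrableOn_VaR hX hXi
  have hα1 : 0 < 1 - α := sub_pos.2 hα.2
  have hVi' : IntegrableOn (VaR P X) (Ioc α 1) := by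
    rw [integrableOn_Ioc_iff_integrableOn_Ioo]
    exact hVi.mono_set (Ioo_subset_Ioo_left hα.1)
  have hlow : (t - α) * m ≤ ∫ u in Ioo α t, VaR P X u := by
    have := setIntegral_mono_on (integrable_const m)
      (hVi.mono_set (Ioo_subset_Ioo hα.1 ht.2)) measurableSet_Ioo
      fun u hu => hm u (Ioo_subset_Ioo hα.1 ht.2 hu)
    simpa [Real.volume_real_Ioo_of_le ht.1] using this
  have hhigh : (1 - t) * M ≤ ∫ u in Ioo t 1, VaR P X u := by
    have hsub' : Ioo t 1 ⊆ Ioo (0 : ℝ) 1 := Ioo_subset_Ioo_left (hα.1.trans ht.1)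
    have := setIntegral_mono_on (integrable_const M)
      (hVi.mono_set hsub') measurableSet_Ioo fun u hu => hM u (hsub' hu) hu.1
    simpa [Real.volume_real_Ioo_of_le ht.2] using this
  have hsplit : ∫ u in Ioo α 1, VaR P X u =
      (∫ u in Ioo α t, VaR P X u) + ∫ u in Ioo t 1, VaR P X u := by
    rw [← integral_Ioc_eq_integral_Ioo, ← integral_Ioc_eq_integral_Ioo,
      ← integral_Ioc_eq_integral_Ioo, ← Ioc_union_Ioc_eq_Ioc ht.1 ht.2]
    exact setIntegral_union (Ioc_disjoint_Ioc_of_le le_rfl) measurableSet_Ioc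
      (hVi'.mono_set (Ioc_subset_Ioc_right ht.2)) (hVi'.mono_set (Ioc_subset_Ioc_left ht.1))
  rw [rho_cvar hα.1, hsplit]
  gcongr

end CVaR

section Newsvendor

lemma loss_eq (p c x s : ℝ) :
    loss p c x s = (c - p) * x + p * max (x - s) 0 := by
  have : max (-s) (-x) = max (x - s) 0 - x := by
    rw [← max_sub_sub_right]; congr 1 <;> ring
  rw [loss, this]; ring

@[fun_prop]
lemma measurable_loss (p c x : ℝ) : Measurable (loss p c x) := by
  unfold loss; fun_prop

variable {p c μ σ x : ℝ} {P : Measure ℝ}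

lemma integrable_sq_of_mem (hμ : 0 < μ) (hP : P ∈ momentSet μ σ) :
    Integrable (fun s : ℝ => s ^ 2) P :=
  Integrable.of_integral_ne_zero (by rw [hP.2.2.2]; positivity)

lemma integrable_id_of_mem (hμ : 0 < μ) (hP : P ∈ momentSet μ σ) :
    Integrable (fun s : ℝ => s) P :=
  Integrable.of_integral_ne_zero (by rw [hP.2.2.1]; exact hμ.ne')

lemma integrable_loss (hμ : 0 < μ) (hP : P ∈ momentSet μ σ) : Integrable (loss p c x) P := by
  have := hP.1
  exact (((integrable_id_of_mem hμ hP).neg.sup (integrable_const (-x))).const_mul p).add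
    (integrable_const (c * x))

/-- Scarf's bound on the expected surplus, in its quadratic-majorant form. -/
lemma integral_max_sub_le (hμ : 0 < μ) (hP : P ∈ momentSet μ σ) {k : ℝ} (hk : 0 < k) :
    ∫ s, max (x - s) 0 ∂P ≤ ((x - μ + k) ^ 2 + σ ^ 2) / (4 * k) := by
  have := hP.1
  have h₁ := integrable_id_of_mem hμ hP
  have h₂ := integrable_sq_of_mem hμ hP
  have hq : ∀ s : ℝ, max (x - s) 0 ≤ (s ^ 2 - 2 * (x + k) * s + (x + k) ^ 2) / (4 * k) := by
    intro s
    rw [le_div_iff₀ (by positivity)]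
    rcases max_cases (x - s) 0 with ⟨e, _⟩ | ⟨e, _⟩ <;> rw [e]
    · nlinarith [sq_nonneg (x - s - k)]
    · nlinarith [sq_nonneg (x - s + k)]
  have hi₁ : Integrable (fun s : ℝ => s ^ 2 - 2 * (x + k) * s) P := h₂.sub (h₁.const_mul _)
  have hi : Integrable (fun s : ℝ => (s ^ 2 - 2 * (x + k) * s + (x + k) ^ 2) / (4 * k)) P :=
    (hi₁.add (integrable_const _)).div_const _
  have hl : Integrable (fun s : ℝ => max (x - s) 0) P :=
    ((integrable_const x).sub h₁).sup (integrable_const 0)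
  refine (integral_mono hl hi hq).trans_eq ?_
  rw [integral_div, integral_add hi₁ (integrable_const _), integral_sub h₂ (h₁.const_mul _),
    integral_const_mul, hP.2.2.1, hP.2.2.2]
  simp
  ring

variable {α : ℝ}

lemma rho_loss_le (hα : α ∈ Ico (0 : ℝ) 1) (hμ : 0 < μ) (hp : 0 < p)
    (hP : P ∈ momentSet μ σ) {k : ℝ} (hk : 0 < k) :
    rho (fun v => max (v - α) 0 / (1 - α)) P (loss p c x) ≤
      (c - p) * x + p / (1 - α) * (((x - μ + k) ^ 2 + σ ^ 2) / (4 * k)) := by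
  have := hP.1
  have hα1 : 0 < 1 - α := sub_pos.2 hα.2
  have hE : ∫ s, loss p c x s ∂P = (c - p) * x + p * ∫ s, max (x - s) 0 ∂P := by
    have hl : Integrable (fun s : ℝ => max (x - s) 0) P :=
      ((integrable_const x).sub (integrable_id_of_mem hμ hP)).sup (integrable_const 0)
    simp only [loss_eq]
    rw [integral_add (integrable_const _) (hl.const_mul p), integral_const_mul p, integral_const,
      probReal_univ, one_smul]
  have hb := rho_cvar_le hα (measurable_loss p c x) (integrable_loss hμ hP)
    (v := (c - p) * x) fun s => by
      rw [loss_eq]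
      exact le_add_of_nonneg_right (mul_nonneg hp.le (le_max_right _ _))
  refine hb.trans ?_
  rw [hE, add_sub_cancel_left, mul_div_right_comm]
  gcongr
  exact integral_max_sub_le hμ hP hk

lemma bddAbove_rho_loss (hα : α ∈ Ico (0 : ℝ) 1) (hμ : 0 < μ) (hp : 0 < p) :
    BddAbove ((fun P => rho (fun v => max (v - α) 0 / (1 - α)) P (loss p c x)) ''
      momentSet μ σ) :=
  ⟨_, forall_mem_image.2 fun _ hP => rho_loss_le hα hμ hp hP one_pos⟩

/-- The distribution with mass `w` at `a` and mass `1 - w` at `b`. -/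
noncomputable def twoPoint (w a b : ℝ) : Measure ℝ :=
  ENNReal.ofReal w • Measure.dirac a + ENNReal.ofReal (1 - w) • Measure.dirac b

variable {w a b : ℝ}

lemma isProbabilityMeasure_twoPoint (hw : w ∈ Icc (0 : ℝ) 1) :
    IsProbabilityMeasure (twoPoint w a b) :=
  ⟨by simp [twoPoint, ← ENNReal.ofReal_add hw.1 (sub_nonneg.2 hw.2)]⟩

lemma integral_twoPoint (hw : w ∈ Icc (0 : ℝ) 1) (f : ℝ → ℝ) :
    ∫ s, f s ∂(twoPoint w a b) = w * f a + (1 - w) * f b := by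
  have hi : ∀ y, Integrable f (Measure.dirac y) := fun y => integrable_dirac (by simp)
  rw [twoPoint, integral_add_measure ((hi a).smul_measure ENNReal.ofReal_ne_top)
    ((hi b).smul_measure ENNReal.ofReal_ne_top)]
  simp [hw.1, hw.2]

lemma twoPoint_mem_momentSet (hw : w ∈ Icc (0 : ℝ) 1) (ha : 0 ≤ a) (hb : 0 ≤ b)
    (h₁ : w * a + (1 - w) * b = μ) (h₂ : w * a ^ 2 + (1 - w) * b ^ 2 = μ ^ 2 + σ ^ 2) :
    twoPoint w a b ∈ momentSet μ σ := by
  refine ⟨isProbabilityMeasure_twoPoint hw, ?_, ?_, ?_⟩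
  · simp [twoPoint, ha, hb]
  · rw [integral_twoPoint hw fun s => s, h₁]
  · rw [integral_twoPoint hw fun s => s ^ 2, h₂]

lemma le_rho_loss_twoPoint (hα : α ∈ Ico (0 : ℝ) 1) (hμ : 0 < μ) (hc : 0 < c) (hcp : c < p)
    (hw : w ∈ Icc (0 : ℝ) 1) (hab : a ≤ b) (hP : twoPoint w a b ∈ momentSet μ σ)
    (hη : (1 - α) * (1 - c / p) ≤ w) :
    -(p - c) * a ≤
      rho (fun v => max (v - α) 0 / (1 - α)) (twoPoint w a b) (loss p c x) := by
  have := hP.1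
  have hp : 0 < p := hc.trans hcp
  have hα1 : 0 < 1 - α := sub_pos.2 hα.2
  have hcp1 : c / p < 1 := (div_lt_one hp).2 hcp
  have hcp0 : 0 < c / p := div_pos hc hp
  have hanti : loss p c x b ≤ loss p c x a := by
    unfold loss; gcongr
  have hprob : ∀ t, (twoPoint w a b {s | loss p c x s ≤ t}).toReal =
      w * {s | loss p c x s ≤ t}.indicator 1 a +
        (1 - w) * {s | loss p c x s ≤ t}.indicator 1 b := fun t => by
    have hmeas : MeasurableSet {s | loss p c x s ≤ t} :=
      measurableSet_le (measurable_loss p c x) measurable_const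
    rw [← integral_twoPoint hw, integral_indicator_one hmeas]
    rfl
  have hlow := le_rho_cvar (P := twoPoint w a b) (t := 1 - (1 - α) * (1 - c / p))
    (m := loss p c x b) (M := loss p c x a) hα (measurable_loss p c x) (integrable_loss hμ hP)
    ⟨by linarith [mul_pos hα1 hcp0], by linarith [mul_pos hα1 (sub_pos.2 hcp1)]⟩
    (fun u hu => le_VaR (measurable_loss p c x) hu fun t ht => by
      rw [hprob, indicator_of_notMem (by simpa using ht.trans_le hanti),
        indicator_of_notMem (by simpa using ht)]
      simpa using hu.1)
    (fun u hu htu => le_VaR (measurable_loss p c x) hu fun t ht => by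
      rw [hprob, indicator_of_notMem (by simpa using ht)]
      have hle : {s | loss p c x s ≤ t}.indicator (1 : ℝ → ℝ) b ≤ 1 :=
        indicator_le_self' (fun _ _ => zero_le_one) b
      nlinarith [hw.2])
  refine le_trans ?_ hlow
  have hval : ((1 - (1 - α) * (1 - c / p) - α) * loss p c x b +
      (1 - (1 - (1 - α) * (1 - c / p))) * loss p c x a) / (1 - α) =
      c / p * loss p c x b + (1 - c / p) * loss p c x a := by
    field_simp; ring
  rw [hval, loss_eq, loss_eq]
  have hexp : c / p * ((c - p) * x + p * max (x - b) 0) +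
      (1 - c / p) * ((c - p) * x + p * max (x - a) 0) =
      (c - p) * x + c * max (x - b) 0 + (p - c) * max (x - a) 0 := by
    field_simp; ring
  rw [hexp]
  nlinarith [mul_nonneg hc.le (le_max_right (x - b) 0),
    mul_le_mul_of_nonneg_left (le_max_left (x - a) 0) (sub_pos.2 hcp).le]

lemma le_wcInner_of_twoPoint (hα : α ∈ Ico (0 : ℝ) 1) (hμ : 0 < μ) (hc : 0 < c) (hcp : c < p)
    (hw : w ∈ Icc (0 : ℝ) 1) (hab : a ≤ b) (hP : twoPoint w a b ∈ momentSet μ σ)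
    (hη : (1 - α) * (1 - c / p) ≤ w) (x : ℝ) :
    -(p - c) * a ≤ wcInner (fun v => max (v - α) 0 / (1 - α)) p c μ σ x :=
  (le_rho_loss_twoPoint hα hμ hc hcp hw hab hP hη).trans
    (le_csSup (bddAbove_rho_loss hα hμ (hc.trans hcp)) (mem_image_of_mem _ hP))

/-- Weak duality is tight when `V` bounds every inner value below and is attained at `x`. -/
lemma wcRisk_eq_of_forall_le {h : ℝ → ℝ} {V : ℝ} (hx : 0 ≤ x)
    (hlow : ∀ y, V ≤ wcInner h p c μ σ y) (hup : wcInner h p c μ σ x ≤ V) :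
    wcRisk h p c μ σ = V ∧ wcInner h p c μ σ x = wcRisk h p c μ σ := by
  have heq : wcInner h p c μ σ x = V := hup.antisymm (hlow x)
  have hV : wcRisk h p c μ σ = V :=
    IsLeast.csInf_eq ⟨⟨x, hx, heq⟩, forall_mem_image.2 fun y _ => hlow y⟩
  exact ⟨hV, heq.trans hV.symm⟩

lemma rho_loss_zero {h : ℝ → ℝ} (hP : P ∈ momentSet μ σ) : rho h P (loss p c 0) = 0 := by
  have := hP.1
  have hnn : ∀ᵐ s ∂P, 0 ≤ s := by
    rw [ae_iff]
    convert hP.2.1 using 2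
    ext s
    simp
  have hV : ∀ u ∈ Ioo (0 : ℝ) 1, VaR P (loss p c 0) u = 0 := by
    intro u hu
    have hae : ∀ᵐ s ∂P, loss p c 0 s = 0 := by
      filter_upwards [hnn] with s hs
      simp [loss, hs]
    refine le_antisymm ((VaR_le_iff (measurable_loss p c 0) hu 0).2 ?_)
      (le_VaR (measurable_loss p c 0) hu fun t ht => ?_)
    · have : P {s | loss p c 0 s ≤ 0} = 1 :=
        (mem_ae_iff_prob_eq_one (measurableSet_le (measurable_loss p c 0) measurable_const)).1
          (hae.mono fun s hs => hs.le)
      simpa [this] using hu.2.le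
    · have : P {s | loss p c 0 s ≤ t} = 0 :=
        measure_eq_zero_iff_ae_notMem.2 (hae.mono fun s hs => by simpa [hs] using ht)
      simpa [this] using hu.1
  exact (setIntegral_congr_fun measurableSet_Ioo fun u hu => by
    simp [hV u hu]).trans (integral_zero _ _)

end Newsvendor

end NV

open NV MeasureTheory
/-- CVaR special case (Natarajan–Sim–Teo rule). -/
theorem stmt14 (p c μ σ : ℝ) (hc : 0 < c) (hcp : c < p) (hμ : 0 < μ) (hσ : 0 < σ)
    (α : ℝ) (hα : α ∈ Set.Ico (0 : ℝ) 1)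
    (h : ℝ → ℝ) (hh : h = fun u => max (u - α) 0 / (1 - α))
    (η : ℝ) (hη : η = (1 - α) * (1 - c / p)) :
    (η ≤ σ ^ 2 / (μ ^ 2 + σ ^ 2) →
      wcRisk h p c μ σ = 0 ∧ wcInner h p c μ σ 0 = wcRisk h p c μ σ) ∧
    (σ ^ 2 / (μ ^ 2 + σ ^ 2) < η →
      wcRisk h p c μ σ = (p - c) * (-μ + σ * Real.sqrt ((1 - η) / η)) ∧
      0 ≤ μ + σ * (2 * η - 1) / (2 * Real.sqrt (η * (1 - η))) ∧
      wcInner h p c μ σ (μ + σ * (2 * η - 1) / (2 * Real.sqrt (η * (1 - η)))) =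
        wcRisk h p c μ σ) := by
  subst hh
  have hp : 0 < p := hc.trans hcp
  have hcp0 : 0 < c / p := div_pos hc hp
  have hα1 : 0 < 1 - α := sub_pos.2 hα.2
  constructor
  · intro hle
    have hw : σ ^ 2 / (μ ^ 2 + σ ^ 2) ∈ Set.Icc (0 : ℝ) 1 :=
      ⟨by positivity, (div_le_one (by positivity)).2 (by nlinarith [sq_nonneg μ])⟩
    have hb : 0 ≤ (μ ^ 2 + σ ^ 2) / μ := by positivity
    have hP : twoPoint (σ ^ 2 / (μ ^ 2 + σ ^ 2)) 0 ((μ ^ 2 + σ ^ 2) / μ) ∈ momentSet μ σ :=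
      twoPoint_mem_momentSet hw le_rfl hb (by field_simp; ring) (by field_simp; ring)
    refine wcRisk_eq_of_forall_le le_rfl (fun y => ?_) ?_
    · simpa using le_wcInner_of_twoPoint hα hμ hc hcp hw hb hP (hη ▸ hle) y
    · exact csSup_le (Set.Nonempty.image _ ⟨_, hP⟩)
        (Set.forall_mem_image.2 fun P hP => (rho_loss_zero hP).le)
  · intro hlt
    have hη0 : 0 < η := lt_of_le_of_lt (by positivity) hlt
    have hη1 : 0 < 1 - η := by
      have : 1 - η = α + (1 - α) * (c / p) := by rw [hη]; ring
      exact this ▸ add_pos_of_nonneg_of_pos hα.1 (mul_pos hα1 hcp0)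
    have hsq : √(η * (1 - η)) ^ 2 = η * (1 - η) := Real.sq_sqrt (by positivity)
    have hr : √((1 - η) / η) = (1 - η) / √(η * (1 - η)) := by
      rw [Real.sqrt_eq_iff_mul_self_eq (by positivity) (by positivity)]
      field_simp
      rw [hsq]
    have hr0 : 0 < √(η * (1 - η)) := Real.sqrt_pos.2 (by positivity)
    rw [hr]
    generalize √(η * (1 - η)) = s at *
    have ha : 0 ≤ μ - σ * ((1 - η) / s) := by
      rw [div_lt_iff₀ (by positivity)] at hlt
      refine sub_nonneg.2 (abs_le_of_sq_le_sq' ?_ hμ.le).2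
      have : (σ * ((1 - η) / s)) ^ 2 = σ ^ 2 * (1 - η) / η := by
        rw [mul_pow, div_pow, hsq]; field_simp
      rw [this, div_le_iff₀ hη0]
      linarith
    have hb : 0 ≤ μ + σ * (η / s) := by positivity
    have hw : η ∈ Set.Icc (0 : ℝ) 1 := ⟨hη0.le, (sub_pos.1 hη1).le⟩
    have hab : μ - σ * ((1 - η) / s) ≤ μ + σ * (η / s) := by
      exact (sub_le_self μ (by positivity)).trans (le_add_of_nonneg_right (by positivity))
    have hP : twoPoint η (μ - σ * ((1 - η) / s)) (μ + σ * (η / s)) ∈ momentSet μ σ := by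
      refine twoPoint_mem_momentSet hw ha hb (by ring) ?_
      have : η * (μ - σ * ((1 - η) / s)) ^ 2 + (1 - η) * (μ + σ * (η / s)) ^ 2 =
          μ ^ 2 + σ ^ 2 * (η * (1 - η)) / s ^ 2 := by ring
      rw [this, hsq, mul_div_assoc, div_self (by positivity), mul_one]
    have hx : μ + σ * (2 * η - 1) / (2 * s) =
        (μ - σ * ((1 - η) / s) + (μ + σ * (η / s))) / 2 := by
      field_simp; ring
    have hx0 : 0 ≤ μ + σ * (2 * η - 1) / (2 * s) := by rw [hx]; positivity
    have hmain := wcRisk_eq_of_forall_le (h := fun u => max (u - α) 0 / (1 - α))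
      (V := (p - c) * (-μ + σ * ((1 - η) / s))) hx0
      (fun y => by
        refine le_trans (le_of_eq ?_) (le_wcInner_of_twoPoint hα hμ hc hcp hw hab hP hη.ge y)
        ring)
      (csSup_le (Set.Nonempty.image _ ⟨_, hP⟩) (Set.forall_mem_image.2 fun P hP => by
        refine (rho_loss_le hα hμ hp hP (k := σ / (2 * s)) (by positivity)).trans_eq ?_
        have hpη : p / (1 - α) = (p - c) / η := by
          rw [hη]
          have := (sub_pos.2 hcp).ne'
          field_simp
        have hscarf : ((μ + σ * (2 * η - 1) / (2 * s) - μ + σ / (2 * s)) ^ 2 + σ ^ 2) /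
            (4 * (σ / (2 * s))) = σ * η / (2 * s) := by
          field_simp
          linear_combination 4 * σ ^ 2 * hsq
        rw [hpη, hscarf]
        field_simp
        ring))
    exact ⟨hmain.1, hx0, hmain.2⟩
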